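/- arXiv:1709.05053 — 3 statements merged into one kernel-verified Lean document; each statement's English description precedes it below -/
import Mathlib

section
/- If x₁ and x₂ are solutions of x′(t) = (A + E(t))·x(t) such that both e^{t}·x₁(t) and e^{t}·x₂(t) converge in ℝ^{2n} as t → +∞ and have the same limit, then x₁ = x₂. In particular, for each j the decaying solution x with e^{t}·x(t) → e_j⁻ as t → +∞ is uniquely determined by this asymptotic condition. -/
open Real Filter Topology

noncomputable section

/-- The phase space `ℝ^{2n} = ℝⁿ × ℝⁿ` with the Euclidean norm. -/
abbrev EucV (n : ℕ) := EuclideanSpace ℝ (Fin n ⊕ Fin n)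

/-- The block matrix `A = [[0, I],[I, 0]]`, i.e. `A (y, z) = (z, y)`. -/
def Amap (n : ℕ) : EucV n →L[ℝ] EucV n :=
  LinearMap.toContinuousLinearMap
    { toFun := fun x => (WithLp.equiv 2 _).symm fun i => x i.swap
      map_add' := fun _ _ => rfl
      map_smul' := fun _ _ => rfl }

/-- `x` is a solution of `x′(t) = (A + E(t))·x(t)`. -/
def IsSol (n : ℕ) (E : ℝ → (EucV n →L[ℝ] EucV n)) (x : ℝ → EucV n) : Prop :=
  ∀ t : ℝ, HasDerivAt x (Amap n (x t) + E t (x t)) t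

/-- The eigenvector `e_j^σ = (e_j, σ e_j)` of `A`, for `σ = ±1`. -/
def eVec (n : ℕ) (σ : ℝ) (j : Fin n) : EucV n :=
  EuclideanSpace.single (Sum.inl j) (1 : ℝ) + EuclideanSpace.single (Sum.inr j) σ

theorem norm_Amap (n : ℕ) (x : EucV n) : ‖Amap n x‖ = ‖x‖ := by
  rw [EuclideanSpace.norm_eq, EuclideanSpace.norm_eq]
  congr 1
  exact Equiv.sum_comp (Equiv.sumComm (Fin n) (Fin n)) fun i => ‖x i‖ ^ 2

theorem IsSol.sub {n : ℕ} {E : ℝ → (EucV n →L[ℝ] EucV n)} {x y : ℝ → EucV n}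
    (hx : IsSol n E x) (hy : IsSol n E y) : IsSol n E (x - y) := fun t => by
  have h := (hx t).sub (hy t)
  rw [add_sub_add_comm, ← map_sub, ← map_sub] at h
  exact h

/-- Along a solution `x`, the function `e^{2t} ‖x t‖²` becomes monotone after multiplication by the
integrating factor `exp (-2 C₀ e^{-t})`. -/
theorem IsSol.monotone_weighted_norm_sq {n : ℕ} {E : ℝ → (EucV n →L[ℝ] EucV n)} {C₀ : ℝ}
    (hC₀ : 0 ≤ C₀) (hEb : ∀ t : ℝ, ‖E t‖ ≤ C₀ * Real.exp (-|t|))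
    {x : ℝ → EucV n} (hx : IsSol n E x) :
    Monotone fun t : ℝ =>
      Real.exp (2 * t) * Real.exp (-(2 * C₀ * Real.exp (-t))) * ‖x t‖ ^ 2 := by
  have hderiv (t : ℝ) : HasDerivAt (fun t : ℝ =>
      Real.exp (2 * t) * Real.exp (-(2 * C₀ * Real.exp (-t))) * ‖x t‖ ^ 2)
      (2 * (Real.exp (2 * t) * Real.exp (-(2 * C₀ * Real.exp (-t)))) *
        ((1 + C₀ * Real.exp (-t)) * ‖x t‖ ^ 2 +
          inner ℝ (x t) (Amap n (x t) + E t (x t)))) t := by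
    have h₁ : HasDerivAt (fun t : ℝ => Real.exp (2 * t)) (Real.exp (2 * t) * (2 * 1)) t :=
      ((hasDerivAt_id t).const_mul 2).exp
    have h₂ : HasDerivAt (fun t : ℝ => Real.exp (-(2 * C₀ * Real.exp (-t))))
        (Real.exp (-(2 * C₀ * Real.exp (-t))) * -(2 * C₀ * (Real.exp (-t) * -1))) t :=
      (((hasDerivAt_id t).neg.exp).const_mul (2 * C₀)).neg.exp
    refine ((h₁.mul h₂).mul (hx t).norm_sq).congr_deriv ?_
    simp only [Pi.mul_apply]
    ring
  refine monotone_of_deriv_nonneg (fun t => (hderiv t).differentiableAt) fun t => ?_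
  rw [(hderiv t).deriv]
  refine mul_nonneg (by positivity) ?_
  have hE : ‖E t‖ ≤ C₀ * Real.exp (-t) :=
    (hEb t).trans (by gcongr; exact le_abs_self t)
  have hv : ‖Amap n (x t) + E t (x t)‖ ≤ (1 + C₀ * Real.exp (-t)) * ‖x t‖ := by
    calc ‖Amap n (x t) + E t (x t)‖ ≤ ‖Amap n (x t)‖ + ‖E t (x t)‖ := norm_add_le _ _
      _ ≤ ‖x t‖ + C₀ * Real.exp (-t) * ‖x t‖ := by
          rw [norm_Amap]
          gcongr
          exact (E t).le_of_opNorm_le hE _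
      _ = (1 + C₀ * Real.exp (-t)) * ‖x t‖ := by ring
  have hi := neg_le_of_abs_le (abs_real_inner_le_norm (x t) (Amap n (x t) + E t (x t)))
  nlinarith [mul_le_mul_of_nonneg_left hv (norm_nonneg (x t))]

/-- A solution which is `o(e^{-t})` as `t → +∞` vanishes identically. -/
theorem IsSol.eq_zero_of_tendsto {n : ℕ} {E : ℝ → (EucV n →L[ℝ] EucV n)} {C₀ : ℝ}
    (hC₀ : 0 ≤ C₀) (hEb : ∀ t : ℝ, ‖E t‖ ≤ C₀ * Real.exp (-|t|))
    {x : ℝ → EucV n} (hx : IsSol n E x)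
    (h : Tendsto (fun t : ℝ => Real.exp t • x t) atTop (𝓝 0)) : x = 0 := by
  have hsq : Tendsto (fun t : ℝ => Real.exp (2 * t) * ‖x t‖ ^ 2) atTop (𝓝 0) := by
    have := h.norm.pow 2
    simp only [norm_zero, ne_eq, OfNat.ofNat_ne_zero, not_false_eq_true, zero_pow] at this
    refine this.congr fun t => ?_
    rw [norm_smul, Real.norm_of_nonneg (Real.exp_pos t).le, mul_pow, two_mul, Real.exp_add, sq]
  have hlim : Tendsto (fun t : ℝ =>
      Real.exp (2 * t) * Real.exp (-(2 * C₀ * Real.exp (-t))) * ‖x t‖ ^ 2) atTop (𝓝 0) := by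
    refine squeeze_zero (fun t => by positivity) (fun t => ?_) hsq
    have : Real.exp (-(2 * C₀ * Real.exp (-t))) ≤ 1 :=
      Real.exp_le_one_iff.2 (neg_nonpos.2 (by positivity))
    gcongr
    exact mul_le_of_le_one_right (Real.exp_pos _).le this
  funext t
  have hle := (hx.monotone_weighted_norm_sq hC₀ hEb).ge_of_tendsto hlim t
  have : ‖x t‖ ^ 2 ≤ 0 := nonpos_of_mul_nonpos_right hle (by positivity)
  simpa using pow_eq_zero_iff two_ne_zero |>.1 (this.antisymm (by positivity))

/-- A solution with prescribed limit of `e^{t} x(t)` as `t → +∞` is uniquely determined: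
if two solutions have the same limit of `e^t x(t)` at `+∞`, they coincide.  In particular
the decaying solution with `e^t x(t) → e_j⁻` is unique. -/
theorem solution_unique_of_decaying_asymptotics
    (n : ℕ) (hn : 1 ≤ n)
    (E : ℝ → (EucV n →L[ℝ] EucV n)) (hE : Continuous E)
    (C₀ : ℝ) (hC₀ : 0 < C₀)
    (hEb : ∀ t : ℝ, ‖E t‖ ≤ C₀ * Real.exp (-|t|))
    (x₁ x₂ : ℝ → EucV n) (hx₁ : IsSol n E x₁) (hx₂ : IsSol n E x₂)
    (L : EucV n)
    (h₁ : Tendsto (fun t : ℝ => Real.exp t • x₁ t) atTop (𝓝 L))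
    (h₂ : Tendsto (fun t : ℝ => Real.exp t • x₂ t) atTop (𝓝 L)) :
    x₁ = x₂ := by
  refine sub_eq_zero.1 ((hx₁.sub hx₂).eq_zero_of_tendsto hC₀.le hEb ?_)
  have h := h₁.sub h₂
  rw [sub_self] at h
  exact h.congr fun t => (smul_sub _ _ _).symm

end
end

section
/- There exists k > 0 such that for all λ = (λ₁,…,λₙ) ∈ ℝⁿ, μ = (μ₁,…,μₙ) ∈ ℝⁿ and all t ∈ ℝ, one has |Σ_{j=1}^{n} (λ_j x_{+,j}(t) + μ_j x_{−,j}(t))| ≥ k·(|λ|² + |μ|²)^{1/2}·e^{−|t|}. -/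
open Real Filter Topology

noncomputable section

/-- A Grönwall-type lower bound on a half-line: if `‖y'‖ ≤ (a + b e^{-t})‖y‖` for `t ≥ 0`, then
`y` decays at most like `e^{-at}`. -/
theorem norm_mul_exp_le_of_norm_deriv_le {V : Type*} [NormedAddCommGroup V]
    [InnerProductSpace ℝ V] {y y' : ℝ → V} {a b : ℝ} (hb : 0 ≤ b)
    (hy : ∀ t, HasDerivAt y (y' t) t)
    (hy' : ∀ t, 0 ≤ t → ‖y' t‖ ≤ (a + b * Real.exp (-t)) * ‖y t‖) {t : ℝ} (ht : 0 ≤ t) :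
    ‖y 0‖ * (Real.exp (-b) * Real.exp (-(a * t))) ≤ ‖y t‖ := by
  let g : ℝ → ℝ := fun s => 2 * (a * s + b * (1 - Real.exp (-s)))
  have hg : ∀ s, HasDerivAt g (2 * (a + b * Real.exp (-s))) s := by
    intro s
    have h₁ : HasDerivAt (fun s : ℝ => Real.exp (-s)) (Real.exp (-s) * (-1)) s :=
      (hasDerivAt_neg s).exp
    exact ((((hasDerivAt_id s).const_mul a).add ((h₁.const_sub 1).const_mul b)).const_mul
      2).congr_deriv (by ring)
  have hu : ∀ s, HasDerivAt (fun s => ‖y s‖ ^ 2 * Real.exp (g s))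
      (2 * inner ℝ (y s) (y' s) * Real.exp (g s)
        + ‖y s‖ ^ 2 * (Real.exp (g s) * (2 * (a + b * Real.exp (-s))))) s :=
    fun s => (hy s).norm_sq.mul (hg s).exp
  have hmono : MonotoneOn (fun s => ‖y s‖ ^ 2 * Real.exp (g s)) (Set.Ici 0) := by
    refine monotoneOn_of_deriv_nonneg (convex_Ici 0)
      (fun s _ => (hu s).continuousAt.continuousWithinAt)
      (fun s _ => (hu s).differentiableAt.differentiableWithinAt) fun s hs => ?_
    rw [interior_Ici, Set.mem_Ioi] at hs
    rw [(hu s).deriv]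
    have hinner : -(‖y s‖ * ‖y' s‖) ≤ inner ℝ (y s) (y' s) :=
      (abs_le.mp (abs_real_inner_le_norm (y s) (y' s))).1
    have hmul := mul_le_mul_of_nonneg_left (hy' s hs.le) (norm_nonneg (y s))
    have hsum : 0 ≤ 2 * inner ℝ (y s) (y' s) + ‖y s‖ ^ 2 * (2 * (a + b * Real.exp (-s))) := by
      nlinarith
    calc (0 : ℝ) ≤ (2 * inner ℝ (y s) (y' s) + ‖y s‖ ^ 2 * (2 * (a + b * Real.exp (-s))))
          * Real.exp (g s) := mul_nonneg hsum (Real.exp_pos _).le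
      _ = _ := by ring
  have h0 : ‖y 0‖ ^ 2 ≤ ‖y t‖ ^ 2 * Real.exp (g t) := by
    simpa [g] using hmono Set.self_mem_Ici (Set.mem_Ici.mpr ht) ht
  have hgt : Real.exp (g t) ≤ Real.exp (b + a * t) ^ 2 := by
    rw [← Real.exp_nat_mul]
    apply Real.exp_le_exp.mpr
    have := mul_nonneg hb (Real.exp_pos (-t)).le
    simp only [g]
    push_cast
    linarith
  have hle : ‖y 0‖ ≤ ‖y t‖ * Real.exp (b + a * t) := by
    refine le_of_sq_le_sq ?_ (by positivity)
    calc ‖y 0‖ ^ 2 ≤ ‖y t‖ ^ 2 * Real.exp (g t) := h0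
      _ ≤ ‖y t‖ ^ 2 * Real.exp (b + a * t) ^ 2 := by gcongr
      _ = _ := by ring
  calc ‖y 0‖ * (Real.exp (-b) * Real.exp (-(a * t)))
      ≤ ‖y t‖ * Real.exp (b + a * t) * (Real.exp (-b) * Real.exp (-(a * t))) := by gcongr
    _ = ‖y t‖ * Real.exp ((b + a * t) + (-b + -(a * t))) := by
      rw [Real.exp_add _ (-b + -(a * t)), Real.exp_add (-b)]; ring
    _ = ‖y t‖ := by
      rw [show (b + a * t) + (-b + -(a * t)) = 0 by ring, Real.exp_zero, mul_one]

section Solutions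

variable {n : ℕ} {E : ℝ → (EucV n →L[ℝ] EucV n)} {C₀ : ℝ}

theorem IsSol.add {x y : ℝ → EucV n} (hx : IsSol n E x) (hy : IsSol n E y) :
    IsSol n E fun t => x t + y t := fun t =>
  ((hx t).add (hy t)).congr_deriv <| by
    simp only [map_add]
    abel

theorem IsSol.sum_smul {ι : Type*} [Fintype ι] {x : ι → ℝ → EucV n} (hx : ∀ j, IsSol n E (x j))
    (c : ι → ℝ) : IsSol n E fun t => ∑ j, c j • x j t := fun t =>
  (HasDerivAt.fun_sum fun j (_ : j ∈ Finset.univ) => (hx j t).const_smul (c j)).congr_deriv <| by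
    simp only [map_sum, map_smul, smul_add, Finset.sum_add_distrib]

theorem norm_vectorField_le (hEb : ∀ t : ℝ, ‖E t‖ ≤ C₀ * Real.exp (-|t|)) (t : ℝ) (v : EucV n) :
    ‖Amap n v + E t v‖ ≤ (1 + C₀ * Real.exp (-|t|)) * ‖v‖ :=
  calc ‖Amap n v + E t v‖ ≤ ‖Amap n v‖ + ‖E t v‖ := norm_add_le _ _
    _ ≤ ‖v‖ + C₀ * Real.exp (-|t|) * ‖v‖ := by
      rw [norm_Amap]
      gcongr
      exact (E t).le_of_opNorm_le (hEb t) v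
    _ = _ := by ring

theorem IsSol.norm_zero_mul_exp_le (hC₀ : 0 ≤ C₀)
    (hEb : ∀ t : ℝ, ‖E t‖ ≤ C₀ * Real.exp (-|t|)) {x : ℝ → EucV n} (hx : IsSol n E x) (t : ℝ) :
    ‖x 0‖ * (Real.exp (-C₀) * Real.exp (-|t|)) ≤ ‖x t‖ := by
  rcases le_total 0 t with ht | ht
  · have h := norm_mul_exp_le_of_norm_deriv_le (a := 1) hC₀ hx (fun s hs => by
      simpa only [abs_of_nonneg hs] using norm_vectorField_le hEb s (x s)) ht
    simpa only [one_mul, abs_of_nonneg ht] using h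
  · have hy : ∀ s, HasDerivAt (fun s => x (-s)) (-(Amap n (x (-s)) + E (-s) (x (-s)))) s :=
      fun s => ((hx (-s)).scomp s (hasDerivAt_neg s)).congr_deriv (neg_one_smul ℝ _)
    have h := norm_mul_exp_le_of_norm_deriv_le (a := 1) hC₀ hy (fun s hs => by
      simpa only [norm_neg, abs_neg, abs_of_nonneg hs] using norm_vectorField_le hEb (-s) (x (-s)))
      (neg_nonneg.mpr ht)
    simpa only [one_mul, neg_neg, neg_zero, abs_of_nonpos ht] using h

theorem IsSol.eq_zero_of_nonneg (hC₀ : 0 ≤ C₀)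
    (hEb : ∀ t : ℝ, ‖E t‖ ≤ C₀ * Real.exp (-|t|)) {x : ℝ → EucV n} (hx : IsSol n E x)
    (h0 : x 0 = 0) {t : ℝ} (ht : 0 ≤ t) : x t = 0 := by
  have hy : ∀ s, HasDerivAt (fun s => x (t - s))
      (-(Amap n (x (t - s)) + E (t - s) (x (t - s)))) s :=
    fun s => ((hx (t - s)).scomp s ((hasDerivAt_id s).const_sub t)).congr_deriv (neg_one_smul ℝ _)
  have h := norm_mul_exp_le_of_norm_deriv_le (a := 1 + C₀) le_rfl hy (fun s _ => by
    rw [norm_neg, zero_mul, add_zero]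
    refine (norm_vectorField_le hEb (t - s) (x (t - s))).trans ?_
    gcongr
    exact mul_le_of_le_one_right hC₀ (Real.exp_le_one_iff.mpr (neg_nonpos.mpr (abs_nonneg _)))) ht
  simp only [sub_zero, sub_self, h0, norm_zero] at h
  have hpos : 0 < Real.exp (-0) * Real.exp (-((1 + C₀) * t)) := by positivity
  exact norm_le_zero_iff.mp (nonpos_of_mul_nonpos_left h hpos)

end Solutions

theorem eq_zero_of_sum_smul_eVec_eq_zero {n : ℕ} {σ : ℝ} {c : Fin n → ℝ}
    (h : ∑ j, c j • eVec n σ j = 0) (i : Fin n) : c i = 0 := by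
  have hi := congrArg (fun v : EucV n => v (Sum.inl i)) h
  simpa [eVec, Pi.single_apply] using hi

theorem coeff_eq_zero_of_eventually_combination_eq_zero {n : ℕ} {xp xm : Fin n → ℝ → EucV n}
    (hxp : ∀ j, Tendsto (fun t : ℝ => Real.exp (-t) • xp j t) atTop (𝓝 (eVec n 1 j)))
    (hxm : ∀ j, Tendsto (fun t : ℝ => Real.exp t • xm j t) atTop (𝓝 (eVec n (-1) j)))
    {lam mu : Fin n → ℝ}
    (h : ∀ᶠ t in atTop, ∑ j, lam j • xp j t + ∑ j, mu j • xm j t = 0) :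
    (∀ j, lam j = 0) ∧ ∀ j, mu j = 0 := by
  have hxm0 : ∀ j, Tendsto (fun t : ℝ => Real.exp (-t) • xm j t) atTop (𝓝 0) := by
    intro j
    have hexp : Tendsto (fun t : ℝ => Real.exp (-t) * Real.exp (-t)) atTop (𝓝 0) := by
      simpa using Real.tendsto_exp_neg_atTop_nhds_zero.mul Real.tendsto_exp_neg_atTop_nhds_zero
    have hlim := hexp.smul (hxm j)
    rw [zero_smul] at hlim
    refine hlim.congr fun t => ?_
    rw [smul_smul, mul_assoc, ← Real.exp_add, neg_add_cancel, Real.exp_zero, mul_one]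
  have hlam : ∀ j, lam j = 0 := by
    refine eq_zero_of_sum_smul_eVec_eq_zero (σ := 1) ?_
    have hlim := (tendsto_finsetSum Finset.univ fun j _ => (hxp j).const_smul (lam j)).add
      (tendsto_finsetSum Finset.univ fun j _ => (hxm0 j).const_smul (mu j))
    simp only [smul_zero, Finset.sum_const_zero, add_zero] at hlim
    refine tendsto_nhds_unique hlim (tendsto_const_nhds.congr' ?_)
    filter_upwards [h] with t ht
    have hs := congrArg (fun v => Real.exp (-t) • v) ht
    simpa only [smul_add, Finset.smul_sum, smul_comm (Real.exp (-t)), smul_zero] using hs.symm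
  refine ⟨hlam, eq_zero_of_sum_smul_eVec_eq_zero (σ := -1) ?_⟩
  have hlim := tendsto_finsetSum Finset.univ fun j _ => (hxm j).const_smul (mu j)
  refine tendsto_nhds_unique hlim (tendsto_const_nhds.congr' ?_)
  filter_upwards [h] with t ht
  have hs := congrArg (fun v => Real.exp t • v) ht
  simpa only [hlam, zero_smul, Finset.sum_const_zero, zero_add, Finset.smul_sum,
    smul_comm (Real.exp t), smul_zero] using hs.symm

/-- Lower bound `|Σ λ_j x_{+,j}(t) + Σ μ_j x_{−,j}(t)| ≥ k (|λ|²+|μ|²)^{1/2} e^{−|t|}`,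
uniform in `λ, μ ∈ ℝⁿ` and `t ∈ ℝ`. -/
theorem lower_bound_combination
    (n : ℕ) (hn : 1 ≤ n)
    (E : ℝ → (EucV n →L[ℝ] EucV n)) (hE : Continuous E)
    (C₀ : ℝ) (hC₀ : 0 < C₀)
    (hEb : ∀ t : ℝ, ‖E t‖ ≤ C₀ * Real.exp (-|t|))
    (xp xm : Fin n → ℝ → EucV n)
    (hxp : ∀ j, IsSol n E (xp j)) (hxm : ∀ j, IsSol n E (xm j))
    (hxpAsymp : ∀ j, Tendsto (fun t : ℝ => Real.exp (-t) • xp j t) atTop (𝓝 (eVec n 1 j)))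
    (hxmAsymp : ∀ j, Tendsto (fun t : ℝ => Real.exp t • xm j t) atTop (𝓝 (eVec n (-1) j))) :
    ∃ k : ℝ, 0 < k ∧ ∀ (lam mu : EuclideanSpace ℝ (Fin n)) (t : ℝ),
      k * Real.sqrt (‖lam‖ ^ 2 + ‖mu‖ ^ 2) * Real.exp (-|t|) ≤
        ‖(∑ j : Fin n, lam j • xp j t) + ∑ j : Fin n, mu j • xm j t‖ := by
  have hsol (lam mu : EuclideanSpace ℝ (Fin n)) :
      IsSol n E fun t => (∑ j, lam j • xp j t) + ∑ j, mu j • xm j t :=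
    (IsSol.sum_smul hxp lam).add (IsSol.sum_smul hxm mu)
  let L : WithLp 2 (EuclideanSpace ℝ (Fin n) × EuclideanSpace ℝ (Fin n)) →ₗ[ℝ] EucV n :=
    { toFun := fun p => (∑ j, p.fst j • xp j 0) + ∑ j, p.snd j • xm j 0
      map_add' := fun p q => by
        simp only [WithLp.add_fst, WithLp.add_snd, PiLp.add_apply, add_smul,
          Finset.sum_add_distrib]
        abel
      map_smul' := fun c p => by
        simp only [WithLp.smul_fst, WithLp.smul_snd, PiLp.smul_apply, smul_eq_mul, mul_smul,
          smul_add, Finset.smul_sum, RingHom.id_apply] }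
  have hker : LinearMap.ker L = ⊥ := by
    refine LinearMap.ker_eq_bot'.mpr fun p hp => ?_
    obtain ⟨hfst, hsnd⟩ := coeff_eq_zero_of_eventually_combination_eq_zero hxpAsymp hxmAsymp
      (lam := p.fst) (mu := p.snd) <| by
        filter_upwards [eventually_ge_atTop 0] with t ht
        exact (hsol p.fst p.snd).eq_zero_of_nonneg hC₀.le hEb hp ht
    have hfst' : p.fst = 0 := by ext j; exact hfst j
    have hsnd' : p.snd = 0 := by ext j; exact hsnd j
    rw [← norm_eq_zero, WithLp.prod_norm_eq_of_L2, hfst', hsnd']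
    simp
  obtain ⟨K, hK, hL⟩ := L.exists_antilipschitzWith hker
  have hK' : (0 : ℝ) < K := hK
  refine ⟨(K : ℝ)⁻¹ * Real.exp (-C₀), by positivity, fun lam mu t => ?_⟩
  have hbound : Real.sqrt (‖lam‖ ^ 2 + ‖mu‖ ^ 2)
      ≤ K * ‖(∑ j, lam j • xp j 0) + ∑ j, mu j • xm j 0‖ := by
    have h := hL.le_mul_dist (WithLp.toLp 2 (lam, mu)) 0
    rwa [dist_zero_right, map_zero, dist_zero_right, WithLp.prod_norm_eq_of_L2] at h
  calc (K : ℝ)⁻¹ * Real.exp (-C₀) * Real.sqrt (‖lam‖ ^ 2 + ‖mu‖ ^ 2) * Real.exp (-|t|)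
      = (K : ℝ)⁻¹ * Real.sqrt (‖lam‖ ^ 2 + ‖mu‖ ^ 2) * (Real.exp (-C₀) * Real.exp (-|t|)) := by
        ring
    _ ≤ ‖(∑ j, lam j • xp j 0) + ∑ j, mu j • xm j 0‖
        * (Real.exp (-C₀) * Real.exp (-|t|)) := by
        gcongr
        exact (inv_mul_le_iff₀ hK').mpr hbound
    _ ≤ _ := (hsol lam mu).norm_zero_mul_exp_le hC₀.le hEb t

end
end

section
/- If x is a solution of x′(t) = (A + E(t))·x(t) that is not identically zero, then there exists c > 0 such that |x(t)| ≥ c·e^{−|t|} for all t ∈ ℝ. Equivalently, any solution x satisfying inf_{t∈ℝ} e^{|t|}·|x(t)| = 0 vanishes identically; in particular there is no nonzero Jacobi field along a geodesic of a non-trapping asymptotically hyperbolic manifold that decays faster than e^{−|t|} as t → +∞ or as t → −∞. -/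
open Real Filter Topology

noncomputable section

@[simp]
lemma norm_Amap_apply (n : ℕ) (v : EucV n) : ‖Amap n v‖ = ‖v‖ := by
  have h : ∀ i, (Amap n v) i = v i.swap := fun _ => rfl
  simp only [EuclideanSpace.norm_eq, h]
  congr 1
  exact Equiv.sum_comp (Equiv.sumComm (Fin n) (Fin n)) fun i => ‖v i‖ ^ 2

/-- A linear differential inequality `f′ ≥ -2 (1 + C e^{-t}) f` on `[0, ∞)` forces
`f` to decay at most like `e^{-2t}`. -/
lemma exp_decay_le_of_deriv_ge {f f' : ℝ → ℝ} {C : ℝ} (hC : 0 ≤ C)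
    (hf : ∀ t, HasDerivAt f (f' t) t) (hf0 : ∀ t, 0 ≤ f t)
    (hf' : ∀ t, 0 ≤ t → -(2 * (1 + C * exp (-t)) * f t) ≤ f' t) {t : ℝ} (ht : 0 ≤ t) :
    f 0 * exp (-(2 * C)) * exp (-(2 * t)) ≤ f t := by
  have hd : ∀ s, HasDerivAt (fun s => f s * exp (2 * s - 2 * C * exp (-s)))
      ((f' s + 2 * (1 + C * exp (-s)) * f s) * exp (2 * s - 2 * C * exp (-s))) s := by
    intro s
    have h1 : HasDerivAt (fun s : ℝ => exp (-s)) (exp (-s) * -1) s := (hasDerivAt_neg s).exp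
    have h2 := (((hasDerivAt_id s).const_mul 2).sub (h1.const_mul (2 * C))).exp
    refine ((hf s).mul h2).congr_deriv ?_
    simp only [Pi.sub_apply, id]
    ring
  have hm : MonotoneOn (fun s => f s * exp (2 * s - 2 * C * exp (-s))) (Set.Ici 0) := by
    refine monotoneOn_of_hasDerivWithinAt_nonneg (convex_Ici 0)
      (fun s _ => (hd s).continuousAt.continuousWithinAt)
      (fun s _ => (hd s).hasDerivWithinAt) fun s hs => ?_
    have := hf' s (interior_subset hs)
    exact mul_nonneg (by linarith) (exp_pos _).le
  have h := hm (Set.mem_Ici.2 le_rfl) (Set.mem_Ici.2 ht) ht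
  simp only [mul_zero, neg_zero, exp_zero, mul_one, zero_sub] at h
  calc f 0 * exp (-(2 * C)) * exp (-(2 * t))
      ≤ f t * exp (2 * t - 2 * C * exp (-t)) * exp (-(2 * t)) := by gcongr
    _ = f t * exp (-(2 * C * exp (-t))) := by
        rw [mul_assoc, ← exp_add]; congr 2; ring
    _ ≤ f t := mul_le_of_le_one_right (hf0 t) (exp_le_one_iff.2 (by
        have := exp_pos (-t); simp only [Left.neg_nonpos_iff]; positivity))

/-- A linear differential inequality `f′ ≤ K f` on `[0, ∞)` with `f 0 = 0` forces `f ≤ 0`. -/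
lemma nonpos_of_deriv_le_mul {f f' : ℝ → ℝ} {K : ℝ}
    (hf : ∀ t, HasDerivAt f (f' t) t) (hf0 : f 0 = 0)
    (hf' : ∀ t, 0 ≤ t → f' t ≤ K * f t) {t : ℝ} (ht : 0 ≤ t) : f t ≤ 0 := by
  have hd : ∀ s, HasDerivAt (fun s => f s * exp (-K * s))
      ((f' s - K * f s) * exp (-K * s)) s := by
    intro s
    refine ((hf s).mul ((hasDerivAt_id s).const_mul (-K)).exp).congr_deriv ?_
    simp only [id]
    ring
  have hm : AntitoneOn (fun s => f s * exp (-K * s)) (Set.Ici 0) := by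
    refine antitoneOn_of_hasDerivWithinAt_nonpos (convex_Ici 0)
      (fun s _ => (hd s).continuousAt.continuousWithinAt)
      (fun s _ => (hd s).hasDerivWithinAt) fun s hs => ?_
    have := hf' s (interior_subset hs)
    exact mul_nonpos_of_nonpos_of_nonneg (by linarith) (exp_pos _).le
  have h := hm (Set.mem_Ici.2 le_rfl) (Set.mem_Ici.2 ht) ht
  simp only [hf0, zero_mul] at h
  exact nonpos_of_mul_nonpos_left h (exp_pos _)

/-- A solution of `x′ = (A + E(t)) x` which is not identically zero satisfies the uniform
lower bound `|x(t)| ≥ c e^{−|t|}`; equivalently, a solution decaying faster than `e^{−|t|}`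
vanishes identically. -/
theorem solution_lower_bound_of_ne_zero
    (n : ℕ) (hn : 1 ≤ n)
    (E : ℝ → (EucV n →L[ℝ] EucV n)) (hE : Continuous E)
    (C₀ : ℝ) (hC₀ : 0 < C₀)
    (hEb : ∀ t : ℝ, ‖E t‖ ≤ C₀ * Real.exp (-|t|))
    (x : ℝ → EucV n) (hx : IsSol n E x) (hx0 : x ≠ 0) :
    ∃ c : ℝ, 0 < c ∧ ∀ t : ℝ, c * Real.exp (-|t|) ≤ ‖x t‖ := by
  set g : ℝ → ℝ := fun t => ‖x t‖ ^ 2 with hg_def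
  set g' : ℝ → ℝ := fun t => 2 * inner ℝ (x t) (Amap n (x t) + E t (x t)) with hg'_def
  have hg : ∀ t, HasDerivAt g (g' t) t := fun t => (hx t).norm_sq
  have hg0 : ∀ t, 0 ≤ g t := fun t => sq_nonneg _
  have hb : ∀ t, |g' t| ≤ 2 * (1 + C₀ * exp (-|t|)) * g t := by
    intro t
    have h1 : ‖Amap n (x t) + E t (x t)‖ ≤ (1 + C₀ * exp (-|t|)) * ‖x t‖ := by
      have h2 := norm_add_le (Amap n (x t)) (E t (x t))
      have h3 := (E t).le_of_opNorm_le (hEb t) (x t)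
      rw [norm_Amap_apply] at h2
      linarith
    have h4 := abs_real_inner_le_norm (x t) (Amap n (x t) + E t (x t))
    have h5 := mul_le_mul_of_nonneg_left h1 (norm_nonneg (x t))
    rw [hg'_def, hg_def]
    simp only [abs_mul, abs_two]
    nlinarith
  have hr : ∀ t, HasDerivAt (fun s => g (-s)) (-g' (-t)) t := fun t =>
    ((hg (-t)).comp t (hasDerivAt_neg t)).congr_deriv (by ring)
  have hbK : ∀ t, |g' t| ≤ 2 * (1 + C₀) * g t := fun t => by
    refine (hb t).trans ?_
    have : exp (-|t|) ≤ 1 := exp_le_one_iff.2 (by simp)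
    have := mul_le_mul_of_nonneg_left this hC₀.le
    nlinarith [hg0 t]
  have hpos : 0 < ‖x 0‖ := by
    refine norm_pos_iff.2 fun h0 => hx0 (funext fun t => ?_)
    have hgz : g 0 = 0 := by simp [hg_def, h0]
    have ht : g t ≤ 0 := by
      rcases le_total 0 t with ht | ht
      · exact nonpos_of_deriv_le_mul hg hgz (fun s _ => (le_abs_self _).trans (hbK s)) ht
      · simpa using nonpos_of_deriv_le_mul hr (by simpa using hgz)
          (fun s _ => (neg_le_abs _).trans (hbK (-s))) (neg_nonneg.2 ht)
    exact norm_eq_zero.1 (pow_eq_zero_iff two_ne_zero |>.1 (le_antisymm ht (hg0 t)))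
  have key : ∀ t, g 0 * exp (-(2 * C₀)) * exp (-(2 * |t|)) ≤ g t := by
    intro t
    rcases le_total 0 t with ht | ht
    · rw [abs_of_nonneg ht]
      refine exp_decay_le_of_deriv_ge hC₀.le hg hg0 (fun s hs => ?_) ht
      have := hb s
      rw [abs_of_nonneg hs] at this
      exact neg_le_of_abs_le this
    · rw [abs_of_nonpos ht]
      have := exp_decay_le_of_deriv_ge hC₀.le hr (fun s => hg0 (-s)) (fun s hs => ?_)
        (neg_nonneg.2 ht)
      · simpa using this
      have := hb (-s)
      rw [abs_neg s, abs_of_nonneg hs] at this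
      exact neg_le_neg ((le_abs_self _).trans this)
  refine ⟨‖x 0‖ * exp (-C₀), by positivity, fun t => ?_⟩
  refine (sq_le_sq₀ (by positivity) (norm_nonneg _)).1 ?_
  refine le_of_eq_of_le ?_ (key t)
  rw [hg_def, mul_pow, mul_pow, ← exp_nat_mul, ← exp_nat_mul]
  push_cast
  simp only [mul_neg]

end
end
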